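/- There exists a universal constant c > 0 such that the following holds. Let k ≥ 2, let ρ be a tail function with smoothness parameter β, let 0 < γ ≤ 1/8, n ≥ 35, T ≥ 1, set η = 1/(6βk), and let 0 < ε < 1/256 satisfy η γ² T ≥ (1/ε) ρ^{−1}(ε/k)². Then there exist a distribution D on ℝ³ × {1,…,k} with ‖x‖₂ ≤ 1 almost surely that is linearly separable with margin γ (i.e. there is W* with ‖W*‖_F ≤ 1 and (W*^y − W*^j)·x ≥ γ for all j ≠ y, D-almost surely), and a loss ℓ(ŷ, y) = ℓ̃(D_y ŷ) whose template ℓ̃ : ℝ^{k−1} → ℝ is nonnegative, convex, β-smooth with respect to the L₂ norm, satisfies ℓ̃(u) ≤ Σ_{j=1}^{k−1} ρ(u_j) on the nonnegative orthant and lim_{t→∞} ℓ̃(tu) = 0 for strictly positive u, such that for the T-th iterate W_T of gradient descent on the empirical risk of an i.i.d. sample S of size n from D with step size η started from W_1 = 0: E_S[L(W_T)] ≥ c ( β k ρ^{−1}(256ε/k)² / (γ² n) + β k ρ^{−1}(16ε/k)² / (γ² T) ), where L(W) = E_{(x,y)~D}[ℓ(Wx, y)]. In particular one may take c = 10^{−7}.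 -/

import Mathlib

open Real Filter MeasureTheory Finset
open scoped ENNReal

/-- The `L_p` norm of a vector in `ℝ^m`, for `p ∈ [1,∞]` (as an `ℝ≥0∞` parameter). -/
noncomputable def pnorm (p : ℝ≥0∞) {m : ℕ} (v : Fin m → ℝ) : ℝ :=
  ‖(WithLp.equiv p (Fin m → ℝ)).symm v‖

/-- The gradient of `f : ℝ^m → ℝ`, as the vector of partial derivatives. -/
noncomputable def grad {m : ℕ} (f : (Fin m → ℝ) → ℝ) (w : Fin m → ℝ) : Fin m → ℝ :=
  fun i => fderiv ℝ f w (Pi.single i 1)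

/-- The Frobenius norm of a `k × d` matrix. -/
noncomputable def frob {k d : ℕ} (A : Fin k → Fin d → ℝ) : ℝ :=
  Real.sqrt (∑ i, ∑ j, A i j ^ 2)

/-- The gradient of a function of a `k × d` matrix, as the matrix of partial derivatives. -/
noncomputable def gradM {k d : ℕ} (f : (Fin k → Fin d → ℝ) → ℝ) (W : Fin k → Fin d → ℝ) :
    Fin k → Fin d → ℝ :=
  fun i j => fderiv ℝ f W (Pi.single i (Pi.single j 1))

/-- The increasing enumeration of `{0, …, k-1} \ {y}` by `Fin (k-1)`. -/
def skipIdx {k : ℕ} (y : Fin k) (j : Fin (k - 1)) : Fin k :=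
  if (j : ℕ) < (y : ℕ) then ⟨j, by have := j.isLt; omega⟩
  else ⟨(j : ℕ) + 1, by have := j.isLt; omega⟩

/-- The linear map `D_y : ℝ^k → ℝ^{k-1}` sending `v` to the vector `(v_y - v_j)_{j ≠ y}`. -/
def Dmap {k : ℕ} (y : Fin k) (v : Fin k → ℝ) : Fin (k - 1) → ℝ :=
  fun j => v y - v (skipIdx y j)

/-- A tail function `ρ : [0,∞) → ℝ` (with values of `ρ` on negatives irrelevant), together with
its (one-sided) derivative `ρ'`: nonnegative, `1`-Lipschitz, convex, `β`-smooth, strictly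
decreasing, tending to `0` at infinity, with `ρ(0) ≥ 1` and `|ρ'(0)| ≥ 1/2`. -/
structure IsTailFunction (β : ℝ) (ρ ρ' : ℝ → ℝ) : Prop where
  nonneg : ∀ x, 0 ≤ x → 0 ≤ ρ x
  lipschitz : ∀ x, 0 ≤ x → ∀ y, 0 ≤ y → |ρ x - ρ y| ≤ |x - y|
  convexOn : ConvexOn ℝ (Set.Ici (0 : ℝ)) ρ
  hasDeriv : ∀ x, 0 ≤ x → HasDerivWithinAt ρ (ρ' x) (Set.Ici 0) x
  smooth : ∀ x, 0 ≤ x → ∀ y, 0 ≤ y → |ρ' x - ρ' y| ≤ β * |x - y|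
  strictAnti : ∀ x, 0 ≤ x → ∀ y, x < y → ρ y < ρ x
  tendsto_zero : Filter.Tendsto ρ Filter.atTop (nhds 0)
  one_le : 1 ≤ ρ 0
  deriv_zero : 1 / 2 ≤ |ρ' 0|

/-- The inverse of a tail function: for `0 < z ≤ ρ 0`, `tailInv ρ z` is the unique `u ≥ 0` with
`ρ u = z`. -/
noncomputable def tailInv (ρ : ℝ → ℝ) (z : ℝ) : ℝ := sInf {u : ℝ | 0 ≤ u ∧ ρ u ≤ z}

/-- Gradient descent iterates on objective `F` with step size `η`, started from `0`:
`gdFrom η F s` is the iterate after `s` gradient steps (so `W_T = gdFrom η F (T - 1)` when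
iterates are numbered `W_1 = 0, W_2, …`). -/
noncomputable def gdFrom {k d : ℕ} (η : ℝ) (F : (Fin k → Fin d → ℝ) → ℝ) :
    ℕ → (Fin k → Fin d → ℝ)
  | 0 => 0
  | t + 1 => gdFrom η F t - η • gradM F (gdFrom η F t)


lemma aux_hasDerivAt_sqplus (x : ℝ) :
    HasDerivAt (fun x : ℝ => (max x 0) ^ 2) (2 * max x 0) x := by
  rcases lt_trichotomy x 0 with h | h | h
  · have : (fun x : ℝ => (max x 0) ^ 2) =ᶠ[nhds x] fun _ => 0 := by
      filter_upwards [Iio_mem_nhds h] with y hy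
      have : y < 0 := hy
      simp [max_eq_right this.le]
    rw [max_eq_right h.le, mul_zero]
    exact (hasDerivAt_const x (0:ℝ)).congr_of_eventuallyEq this
  · subst h
    rw [hasDerivAt_iff_isLittleO]
    simp only [max_self, mul_zero, smul_zero, sub_zero, ne_eq, OfNat.ofNat_ne_zero,
      not_false_eq_true, zero_pow]
    have h1 : (fun x : ℝ => (max x 0) ^ 2) =O[nhds 0] fun x : ℝ => x ^ 2 := by
      apply Asymptotics.IsBigO.of_bound 1
      refine Eventually.of_forall fun y => ?_
      rw [norm_pow, norm_pow, one_mul]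
      gcongr
      simp only [Real.norm_eq_abs]
      rcases le_total y 0 with h | h
      · simp [max_eq_right h]
      · simp [max_eq_left h]
    refine h1.trans_isLittleO ?_
    exact Asymptotics.isLittleO_pow_id (by norm_num)
  · have : (fun x : ℝ => (max x 0) ^ 2) =ᶠ[nhds x] fun x => x ^ 2 := by
      filter_upwards [Ioi_mem_nhds h] with y hy
      have : 0 < y := hy
      simp [max_eq_left this.le]
    rw [max_eq_left h.le]
    have h2 := hasDerivAt_pow 2 x
    simp only [Nat.cast_ofNat, Nat.add_one_sub_one, pow_one] at h2
    exact h2.congr_of_eventuallyEq this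

/-- The scalar loss. -/
noncomputable def auxF (a b r u : ℝ) : ℝ :=
  a / 2 * (max (r - u) 0) ^ 2 + b / 2 * (max (-u) 0) ^ 2

/-- Its derivative. -/
noncomputable def auxF' (a b r u : ℝ) : ℝ :=
  -(a * max (r - u) 0) - b * max (-u) 0

lemma auxF_hasDerivAt (a b r u : ℝ) : HasDerivAt (auxF a b r) (auxF' a b r u) u := by
  have h1 : HasDerivAt (fun u : ℝ => r - u) (-1) u := by
    simpa using (hasDerivAt_id u).const_sub r
  have h2 : HasDerivAt (fun u : ℝ => -u) (-1) u := by
    exact hasDerivAt_neg u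
  have h3 := ((aux_hasDerivAt_sqplus (r - u)).comp u h1).const_mul (a / 2)
  have h4 := ((aux_hasDerivAt_sqplus (-u)).comp u h2).const_mul (b / 2)
  have h5 := h3.add h4
  refine (h5.congr_deriv ?_)
  unfold auxF'
  ring

lemma auxF_nonneg {a b : ℝ} (ha : 0 ≤ a) (hb : 0 ≤ b) (r u : ℝ) : 0 ≤ auxF a b r u := by
  unfold auxF; positivity

lemma auxF'_mono {a b : ℝ} (ha : 0 ≤ a) (hb : 0 ≤ b) (r : ℝ) : Monotone (auxF' a b r) := by
  intro x y hxy
  unfold auxF'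
  have h1 : max (r - y) 0 ≤ max (r - x) 0 := max_le_max (by linarith) le_rfl
  have h2 : max (- y) 0 ≤ max (- x) 0 := max_le_max (by linarith) le_rfl
  have := mul_le_mul_of_nonneg_left h1 ha
  have := mul_le_mul_of_nonneg_left h2 hb
  linarith

lemma auxF_convex {a b : ℝ} (ha : 0 ≤ a) (hb : 0 ≤ b) (r : ℝ) :
    ConvexOn ℝ Set.univ (auxF a b r) := by
  refine Monotone.convexOn_univ_of_deriv (fun u => (auxF_hasDerivAt a b r u).differentiableAt) ?_
  have : deriv (auxF a b r) = auxF' a b r := by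
    ext u; exact (auxF_hasDerivAt a b r u).deriv
  rw [this]
  exact auxF'_mono ha hb r

lemma auxF'_lip {a b β : ℝ} (ha : 0 ≤ a) (hb : 0 ≤ b) (hab : a + b ≤ β) (r x y : ℝ) :
    |auxF' a b r x - auxF' a b r y| ≤ β * |x - y| := by
  unfold auxF'
  have h1 : |max (r - x) 0 - max (r - y) 0| ≤ |x - y| := by
    have := abs_max_sub_max_le_abs (r - x) (r - y) 0
    rwa [show r - x - (r - y) = -(x - y) by ring, abs_neg] at this
  have h2 : |max (- x) 0 - max (- y) 0| ≤ |x - y| := by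
    have := abs_max_sub_max_le_abs (- x) (- y) 0
    rwa [show - x - (- y) = -(x - y) by ring, abs_neg] at this
  calc _ = |a * (max (r - x) 0 - max (r - y) 0) + b * (max (- x) 0 - max (- y) 0)| := by
        rw [← abs_neg]; congr 1; ring
    _ ≤ |a * (max (r - x) 0 - max (r - y) 0)| + |b * (max (- x) 0 - max (- y) 0)| :=
        abs_add_le _ _
    _ = a * |max (r - x) 0 - max (r - y) 0| + b * |max (- x) 0 - max (- y) 0| := by
        rw [abs_mul, abs_mul, abs_of_nonneg ha, abs_of_nonneg hb]
    _ ≤ a * |x - y| + b * |x - y| := by gcongr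
    _ = (a + b) * |x - y| := by ring
    _ ≤ β * |x - y| := by gcongr

/-- The template. -/
noncomputable def auxL (a b r : ℝ) {m : ℕ} (u : Fin m → ℝ) : ℝ := ∑ j, auxF a b r (u j)

lemma auxL_nonneg {a b : ℝ} (ha : 0 ≤ a) (hb : 0 ≤ b) (r : ℝ) {m : ℕ} (u : Fin m → ℝ) :
    0 ≤ auxL a b r u := Finset.sum_nonneg fun _ _ => auxF_nonneg ha hb r _

lemma auxL_hasFDerivAt (a b r : ℝ) {m : ℕ} (u : Fin m → ℝ) :
    HasFDerivAt (auxL a b r (m := m))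
      (∑ j, auxF' a b r (u j) • (ContinuousLinearMap.proj (R := ℝ) (φ := fun _ : Fin m => ℝ) j)) u := by
  unfold auxL
  refine HasFDerivAt.fun_sum fun j _ => ?_
  exact (auxF_hasDerivAt a b r (u j)).comp_hasFDerivAt u
    (ContinuousLinearMap.proj (R := ℝ) (φ := fun _ : Fin m => ℝ) j).hasFDerivAt

lemma auxL_grad (a b r : ℝ) {m : ℕ} (u : Fin m → ℝ) :
    grad (auxL a b r (m := m)) u = fun j => auxF' a b r (u j) := by
  ext i
  unfold grad
  rw [(auxL_hasFDerivAt a b r u).fderiv]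
  simp [Pi.single_apply]

lemma aux_pnorm {m : ℕ} (v : Fin m → ℝ) : pnorm 2 v = Real.sqrt (∑ i, v i ^ 2) := by
  unfold pnorm
  rw [EuclideanSpace.norm_eq]
  simp

lemma auxL_smooth {a b β : ℝ} (ha : 0 ≤ a) (hb : 0 ≤ b) (hab : a + b ≤ β) (r : ℝ) {m : ℕ}
    (u v : Fin m → ℝ) :
    pnorm 2 (grad (auxL a b r (m := m)) u - grad (auxL a b r (m := m)) v) ≤ β * pnorm 2 (u - v) := by
  rw [auxL_grad, auxL_grad, aux_pnorm, aux_pnorm]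
  have hβ : 0 ≤ β := by linarith
  rw [← Real.sqrt_sq hβ, ← Real.sqrt_mul (sq_nonneg β)]
  apply Real.sqrt_le_sqrt
  rw [Finset.mul_sum]
  refine Finset.sum_le_sum fun i _ => ?_
  simp only [Pi.sub_apply]
  rw [← sq_abs, ← sq_abs (u i - v i), ← mul_pow]
  exact pow_le_pow_left₀ (abs_nonneg _) (auxF'_lip ha hb hab r _ _) 2

lemma auxL_convex {a b : ℝ} (ha : 0 ≤ a) (hb : 0 ≤ b) (r : ℝ) {m : ℕ} :
    ConvexOn ℝ Set.univ (auxL a b r (m := m)) := by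
  refine ⟨convex_univ, fun x _ y _ s t hs ht hst => ?_⟩
  unfold auxL
  rw [smul_eq_mul, smul_eq_mul, Finset.mul_sum, Finset.mul_sum, ← Finset.sum_add_distrib]
  refine Finset.sum_le_sum fun i _ => ?_
  simpa using (auxF_convex ha hb r).2 (Set.mem_univ (x i)) (Set.mem_univ (y i)) hs ht hst

lemma auxF_zero {a b r u : ℝ} (hr : 0 ≤ r) (h : r ≤ u) : auxF a b r u = 0 := by
  unfold auxF
  rw [max_eq_right (by linarith), max_eq_right (by linarith)]; simp

lemma auxL_tendsto (a b : ℝ) {r : ℝ} (hr : 0 ≤ r) {m : ℕ} (u : Fin m → ℝ) (hu : ∀ j, 0 < u j) :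
    Filter.Tendsto (fun t : ℝ => auxL a b r (t • u)) Filter.atTop (nhds 0) := by
  have : ∀ᶠ t : ℝ in Filter.atTop, ∀ j, r ≤ t * u j := by
    rw [Filter.eventually_all]
    intro j
    exact (Filter.tendsto_id.atTop_mul_const (hu j)).eventually_ge_atTop r
  refine tendsto_const_nhds.congr' ?_
  filter_upwards [this] with t ht
  unfold auxL
  symm
  exact Finset.sum_eq_zero fun j _ => auxF_zero hr (ht j)

lemma auxF_le {a b r u z : ℝ} (ha : 0 ≤ a) (hu : 0 ≤ u) (h : a / 2 * r ^ 2 ≤ z) (hur : u ≤ r) :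
    auxF a b r u ≤ z := by
  unfold auxF
  rw [max_eq_left (by linarith), max_eq_right (by linarith)]
  have : (r - u) ^ 2 ≤ r ^ 2 := by nlinarith
  have : a / 2 * (r - u) ^ 2 ≤ a / 2 * r ^ 2 := by gcongr
  linarith

lemma tail_set_nonempty {β : ℝ} {ρ ρ' : ℝ → ℝ} (hρ : IsTailFunction β ρ ρ') {z : ℝ} (hz : 0 < z) :
    {u : ℝ | 0 ≤ u ∧ ρ u ≤ z}.Nonempty := by
  have := (hρ.tendsto_zero.eventually (Iio_mem_nhds hz)).and (Filter.eventually_ge_atTop 0)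
  obtain ⟨u, h1, h2⟩ := this.exists
  exact ⟨u, h2, le_of_lt h1⟩

lemma tail_bdd (ρ : ℝ → ℝ) (z : ℝ) : BddBelow {u : ℝ | 0 ≤ u ∧ ρ u ≤ z} := ⟨0, fun _ h => h.1⟩

lemma tail_lt {ρ : ℝ → ℝ} {z u : ℝ} (hu : 0 ≤ u) (h : u < tailInv ρ z) : z < ρ u := by
  by_contra hc
  exact absurd (csInf_le (tail_bdd ρ z) ⟨hu, not_lt.mp hc⟩) (not_le.mpr h)

lemma tail_half {β : ℝ} {ρ ρ' : ℝ → ℝ} (hρ : IsTailFunction β ρ ρ') {z : ℝ} (hz : 0 < z)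
    (hz2 : z ≤ 1 / 2) : 1 / 2 ≤ tailInv ρ z := by
  refine le_csInf (tail_set_nonempty hρ hz) ?_
  rintro u ⟨hu, h⟩
  have h1 := hρ.lipschitz 0 le_rfl u hu
  have h2 := le_abs_self (ρ 0 - ρ u)
  rw [zero_sub, abs_neg, abs_of_nonneg hu] at h1
  linarith [hρ.one_le]

lemma tail_anti {β : ℝ} {ρ ρ' : ℝ → ℝ} (hρ : IsTailFunction β ρ ρ') {z w : ℝ} (hz : 0 < z)
    (hzw : z ≤ w) : tailInv ρ w ≤ tailInv ρ z :=
  csInf_le_csInf (tail_bdd ρ w) (tail_set_nonempty hρ hz) fun _ h => ⟨h.1, h.2.trans hzw⟩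

lemma tail_le {β : ℝ} {ρ ρ' : ℝ → ℝ} (hρ : IsTailFunction β ρ ρ') {z u : ℝ} (hz : 0 < z)
    (h : tailInv ρ z < u) : ρ u ≤ z := by
  obtain ⟨v, hv, hvu⟩ := exists_lt_of_csInf_lt (tail_set_nonempty hρ hz) h
  exact (hρ.strictAnti v hv.1 u hvu).le.trans hv.2

lemma tail_deriv_zero {β : ℝ} (hβ : 0 < β) {ρ ρ' : ℝ → ℝ} (hρ : IsTailFunction β ρ ρ') :
    ρ' 0 ≤ -(1 / 2) := by
  have hanti : AntitoneOn ρ (Set.Ici 0) := by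
    intro x hx y hy hxy
    rcases hxy.eq_or_lt with h | h
    · rw [h]
    · exact (hρ.strictAnti x hx y h).le
  have h0 : ρ' 0 ≤ 0 := by
    by_contra hc
    push Not at hc
    have hcont : ContinuousOn ρ (Set.Icc 0 (ρ' 0 / (2 * β))) := fun x hx =>
      ((hρ.hasDeriv x hx.1).continuousWithinAt).mono (Set.Icc_subset_Ici_self)
    have hp : 0 < ρ' 0 / (2 * β) := by positivity
    obtain ⟨c, hc1, hc2⟩ := exists_hasDerivAt_eq_slope ρ ρ' hp hcont (fun x hx =>
      (hρ.hasDeriv x hx.1.le).hasDerivAt (Ici_mem_nhds hx.1))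
    have h1 := hρ.strictAnti 0 le_rfl _ hp
    have h2 : ρ' c < 0 := by rw [hc2]; exact div_neg_of_neg_of_pos (by linarith) (by linarith)
    have h3 := (le_abs_self _).trans (hρ.smooth 0 le_rfl c hc1.1.le)
    rw [zero_sub, abs_neg, abs_of_pos hc1.1] at h3
    have h4 : β * c < β * (ρ' 0 / (2 * β)) := mul_lt_mul_of_pos_left hc1.2 hβ
    have h5 : β * (ρ' 0 / (2 * β)) = ρ' 0 / 2 := by field_simp
    linarith
  have := hρ.deriv_zero
  rw [abs_of_nonpos h0] at this
  linarith

lemma tail_beta {β : ℝ} (hβ : 0 < β) {ρ ρ' : ℝ → ℝ} (hρ : IsTailFunction β ρ ρ') {z : ℝ}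
    (hz : 0 < z) (hz2 : z ≤ 1 / 512) : 1 / 16 ≤ β * tailInv ρ z ^ 2 := by
  have hR := tail_half hρ hz (by linarith)
  set R := tailInv ρ z with hRdef
  have h2R : ρ (2 * R) ≤ z := tail_le hρ hz (by linarith)
  have hcont : ContinuousOn ρ (Set.Icc (2 * R) (3 * R)) := fun x hx =>
    ((hρ.hasDeriv x (by linarith [hx.1])).continuousWithinAt).mono
      (fun y hy => by have := hy.1; simp only [Set.mem_Ici]; linarith)
  obtain ⟨c, hc1, hc2⟩ := exists_hasDerivAt_eq_slope ρ ρ' (by linarith : 2 * R < 3 * R) hcont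
    (fun x hx => (hρ.hasDeriv x (by linarith [hx.1])).hasDerivAt
      (Ici_mem_nhds (by linarith [hx.1])))
  have h1 := hρ.nonneg (3 * R) (by linarith)
  have hc0 : 0 < c := by linarith [hc1.1]
  have h3 := (le_abs_self _).trans (hρ.smooth c hc0.le 0 le_rfl)
  rw [sub_zero, abs_of_pos hc0] at h3
  have h4 : β * c < β * (3 * R) := mul_lt_mul_of_pos_left hc1.2 hβ
  have h5 := tail_deriv_zero hβ hρ
  rw [eq_div_iff (by linarith)] at hc2
  have h6 : ρ' c * (3 * R - 2 * R) ≥ - (1 / 512) := by linarith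
  have h7 : -(1 / 256) ≤ ρ' c := by
    by_contra hcon
    push Not at hcon
    nlinarith
  have h8 : 1 / 8 ≤ β * R := by linarith
  nlinarith

lemma aux_skip_zero {k : ℕ} [NeZero k] (j : Fin (k - 1)) :
    skipIdx (0 : Fin k) j = ⟨(j : ℕ) + 1, by have := j.isLt; omega⟩ := by
  unfold skipIdx
  simp

lemma aux_skip_ne {k : ℕ} [NeZero k] (j : Fin (k - 1)) : skipIdx (0 : Fin k) j ≠ 0 := by
  rw [aux_skip_zero]
  intro h
  have := congrArg Fin.val h
  simp at this

/-- The direction of the gradient descent path. -/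
def auxV (k : ℕ) [NeZero k] : Fin k → Fin 3 → ℝ := fun i t =>
  if t = 0 then (if i = 0 then (k : ℝ) - 1 else -1) else 0

lemma aux_objective_hasFDerivAt (a b r g : ℝ) {k : ℕ} [NeZero k] (W : Fin k → Fin 3 → ℝ) :
    HasFDerivAt (fun W : Fin k → Fin 3 → ℝ =>
        ∑ j : Fin (k - 1), auxF a b r (g * (W 0 0 - W (skipIdx 0 j) 0)))
      (∑ j : Fin (k - 1), auxF' a b r (g * (W 0 0 - W (skipIdx 0 j) 0)) •
        (g • (((ContinuousLinearMap.proj (R := ℝ) (φ := fun _ : Fin 3 => ℝ) 0).comp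
          (ContinuousLinearMap.proj (R := ℝ) (φ := fun _ : Fin k => Fin 3 → ℝ) 0)) -
        ((ContinuousLinearMap.proj (R := ℝ) (φ := fun _ : Fin 3 => ℝ) 0).comp
          (ContinuousLinearMap.proj (R := ℝ) (φ := fun _ : Fin k => Fin 3 → ℝ) (skipIdx 0 j)))))) W := by
  refine HasFDerivAt.fun_sum fun j _ => ?_
  exact (auxF_hasDerivAt a b r (g * (W 0 0 - W (skipIdx 0 j) 0))).comp_hasFDerivAt W
    (g • (((ContinuousLinearMap.proj (R := ℝ) (φ := fun _ : Fin 3 => ℝ) 0).comp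
          (ContinuousLinearMap.proj (R := ℝ) (φ := fun _ : Fin k => Fin 3 → ℝ) 0)) -
        ((ContinuousLinearMap.proj (R := ℝ) (φ := fun _ : Fin 3 => ℝ) 0).comp
          (ContinuousLinearMap.proj (R := ℝ) (φ := fun _ : Fin k => Fin 3 → ℝ)
            (skipIdx 0 j))))).hasFDerivAt

lemma aux_objective_gradM (a b r g α : ℝ) {k : ℕ} [NeZero k] :
    gradM (fun W : Fin k → Fin 3 → ℝ =>
        ∑ j : Fin (k - 1), auxF a b r (g * (W 0 0 - W (skipIdx 0 j) 0))) (α • auxV k) =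
      (auxF' a b r (g * (k * α)) * g) • auxV k := by
  have hu : ∀ j : Fin (k - 1), g * ((α • auxV k) 0 0 - (α • auxV k) (skipIdx 0 j) 0) =
      g * (k * α) := by
    intro j
    simp only [Pi.smul_apply, auxV, if_true, aux_skip_ne, if_false, smul_eq_mul]
    ring
  ext i t
  unfold gradM
  rw [(aux_objective_hasFDerivAt a b r g (α • auxV k)).fderiv]
  simp only [hu]
  have hk1 : 1 ≤ k := Nat.one_le_iff_ne_zero.mpr (NeZero.ne k)
  simp only [_root_.sum_apply, FunLike.coe_smul, Pi.smul_apply, smul_eq_mul,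
    FunLike.coe_sub, Pi.sub_apply, ContinuousLinearMap.comp_apply,
    ContinuousLinearMap.proj_apply, Function.comp]
  rw [← Finset.mul_sum, mul_assoc, ← Finset.mul_sum]
  congr 2
  by_cases ht : t = 0
  · subst ht
    by_cases hi : i = 0
    · subst hi
      simp [auxV, aux_skip_ne, Pi.single_apply, Nat.cast_sub hk1, apply_ite, ite_apply]
    · have hi' : ∀ j : Fin (k - 1), (skipIdx 0 j = i) ↔ j = ⟨(i : ℕ) - 1, by
          have := i.isLt
          have : (i : ℕ) ≠ 0 := fun h => hi (Fin.ext (by simpa using h))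
          omega⟩ := by
        intro j
        have : (i : ℕ) ≠ 0 := fun h => hi (Fin.ext (by simpa using h))
        rw [aux_skip_zero, Fin.ext_iff, Fin.ext_iff]
        simp only
        omega
      simp [auxV, hi, Pi.single_apply, ite_apply, hi', Ne.symm hi]
  · have h0 : ∀ q : Fin k, (Pi.single i (Pi.single t (1:ℝ)) : Fin k → Fin 3 → ℝ) q 0 = 0 := by
      intro q
      rw [Pi.single_apply]
      split_ifs
      · rw [Pi.single_apply, if_neg (Ne.symm ht)]
      · rfl
    simp [auxV, ht, h0]

lemma auxF'_mid {a b r u : ℝ} (h0 : 0 ≤ u) (h : u ≤ r) : auxF' a b r u = -(a * (r - u)) := by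
  unfold auxF'
  rw [max_eq_left (by linarith), max_eq_right (by linarith)]; ring

lemma aux_gd (a b r g η θ : ℝ) {k : ℕ} [NeZero k] (hr : 0 ≤ r) (hg : 0 < g)
    (hθ : θ = g ^ 2 * k * η * a) (hθ0 : 0 ≤ θ) (hθ1 : θ ≤ 1) (t : ℕ) :
    gdFrom η (fun W : Fin k → Fin 3 → ℝ =>
        ∑ j : Fin (k - 1), auxF a b r (g * (W 0 0 - W (skipIdx 0 j) 0))) t =
      (r * (1 - (1 - θ) ^ t) / (g * k)) • auxV k := by
  have hk0 : (k : ℝ) ≠ 0 := Nat.cast_ne_zero.mpr (NeZero.ne k)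
  induction t with
  | zero => simp [gdFrom]
  | succ t ih =>
    rw [gdFrom, ih, aux_objective_gradM]
    have h1 : g * (k * (r * (1 - (1 - θ) ^ t) / (g * k))) = r * (1 - (1 - θ) ^ t) := by
      field_simp
    have hp0 : 0 ≤ (1 - θ) ^ t := pow_nonneg (by linarith) t
    have hp1 : (1 - θ) ^ t ≤ 1 := pow_le_one₀ (by linarith) (by linarith)
    rw [h1, auxF'_mid (mul_nonneg hr (by linarith)) (by nlinarith), smul_smul, ← sub_smul]
    congr 1
    have : (1 - θ) ^ (t + 1) = (1 - θ) ^ t - g ^ 2 * k * η * a * (1 - θ) ^ t := by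
      rw [pow_succ, ← hθ]; ring
    rw [this]
    field_simp
    ring

lemma aux_integral {n : ℕ} {X : Type*} [MeasurableSpace X] [MeasurableSingletonClass X]
    (z1 z3 : X) {p q : ℝ} (hp : 0 ≤ p) (hq : 0 ≤ q) (hpq : p + q = 1)
    (D : Measure X) [IsProbabilityMeasure D]
    (hD : D = ENNReal.ofReal p • Measure.dirac z1 + ENNReal.ofReal q • Measure.dirac z3)
    (h : (Fin n → X) → X → ℝ) (hh : ∀ ω z, 0 ≤ h ω z) :
    p ^ n * (p * h (fun _ => z1) z1 + q * h (fun _ => z1) z3) ≤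
      ∫ ω : Fin n → X, (∫ z, h ω z ∂D) ∂(Measure.pi fun _ : Fin n => D) := by
  have hin : ∀ ω, ∫ z, h ω z ∂D = p * h ω z1 + q * h ω z3 := by
    intro ω
    rw [hD, integral_add_measure, integral_smul_measure, integral_smul_measure, integral_dirac,
      integral_dirac, ENNReal.toReal_ofReal hp, ENNReal.toReal_ofReal hq, smul_eq_mul, smul_eq_mul]
    · exact (integrable_dirac (by simp)).smul_measure (by simp)
    · exact (integrable_dirac (by simp)).smul_measure (by simp)
  simp only [hin]
  have hnn : ∀ ω, 0 ≤ p * h ω z1 + q * h ω z3 := fun ω =>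
    add_nonneg (mul_nonneg hp (hh _ _)) (mul_nonneg hq (hh _ _))
  have hfin : (Set.univ.pi fun _ : Fin n => ({z1, z3} : Set X)).Finite :=
    Set.Finite.pi fun _ => by simp
  have hD1 : D {z1, z3} = 1 := by
    rw [hD]
    simp only [Measure.add_apply, Measure.smul_apply, smul_eq_mul]
    rw [Measure.dirac_apply_of_mem (by simp), Measure.dirac_apply_of_mem (by simp), mul_one, mul_one,
      ← ENNReal.ofReal_add hp hq, hpq, ENNReal.ofReal_one]
  have hfull : (Measure.pi fun _ : Fin n => D) (Set.univ.pi fun _ : Fin n => ({z1, z3} : Set X)) = 1 := by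
    rw [Measure.pi_pi]; simp [hD1]
  have hint : Integrable (fun ω => p * h ω z1 + q * h ω z3) (Measure.pi fun _ : Fin n => D) := by
    have h1 : IntegrableOn (fun ω => p * h ω z1 + q * h ω z3)
        (Set.univ.pi fun _ : Fin n => ({z1, z3} : Set X)) (Measure.pi fun _ : Fin n => D) :=
      IntegrableOn.of_finite hfin
    have h2 : (Measure.pi fun _ : Fin n => D).restrict
        (Set.univ.pi fun _ : Fin n => ({z1, z3} : Set X)) = Measure.pi fun _ : Fin n => D := by
      apply Measure.restrict_eq_self_of_ae_mem
      exact (prob_compl_eq_zero_iff hfin.measurableSet).mpr hfull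
    rwa [IntegrableOn, h2] at h1
  have hz1 : ENNReal.ofReal p ≤ D {z1} := by
    rw [hD]
    simp only [Measure.add_apply, Measure.smul_apply, smul_eq_mul]
    rw [Measure.dirac_apply_of_mem (by simp), mul_one]
    exact le_self_add
  have hz1' : p ≤ (D {z1}).toReal := by
    rw [← ENNReal.toReal_ofReal hp]
    exact ENNReal.toReal_mono (by simp) hz1
  calc _ ≤ ∫ ω in {(fun _ => z1 : Fin n → X)}, (p * h ω z1 + q * h ω z3)
        ∂(Measure.pi fun _ : Fin n => D) := by
        rw [integral_singleton, smul_eq_mul]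
        refine mul_le_mul_of_nonneg_right ?_ (hnn _)
        rw [measureReal_def, ← Set.univ_pi_singleton, Measure.pi_pi]
        simp only [Finset.prod_const, Finset.card_univ, Fintype.card_fin, ENNReal.toReal_pow]
        exact pow_le_pow_left₀ hp hz1' n
    _ ≤ _ := setIntegral_le_integral hint (Eventually.of_forall hnn)

lemma aux_pow {n : ℕ} (hn : 35 ≤ n) : (1 / 9 : ℝ) ≤ (1 - 1 / (n : ℝ)) ^ (n + 1) := by
  have hn' : (35 : ℝ) ≤ n := by exact_mod_cast hn
  have h1 : 1 - 1 / (n : ℝ) = (1 + 1 / ((n : ℝ) - 1))⁻¹ := by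
    have : (n : ℝ) - 1 ≠ 0 := by linarith
    field_simp
    ring_nf
    field_simp
  rw [h1, inv_pow, one_div]
  have h0 : 0 < (1 + 1 / ((n : ℝ) - 1)) := by
    have : 0 < (n : ℝ) - 1 := by linarith
    positivity
  apply inv_anti₀ (by positivity)
  calc (1 + 1 / ((n : ℝ) - 1)) ^ (n + 1) ≤ (Real.exp (1 / ((n : ℝ) - 1))) ^ (n + 1) := by
        apply pow_le_pow_left₀ h0.le
        linarith [Real.add_one_le_exp (1 / ((n : ℝ) - 1))]
    _ = Real.exp ((n + 1) * (1 / ((n : ℝ) - 1))) := by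
        rw [← Real.exp_nat_mul]; push_cast; rfl
    _ ≤ Real.exp 2 := by
        apply Real.exp_le_exp.mpr
        rw [mul_one_div, div_le_iff₀ (by linarith)]
        linarith
    _ = Real.exp 1 ^ 2 := by rw [← Real.exp_nat_mul]; norm_num
    _ ≤ 3 ^ 2 := by
        apply pow_le_pow_left₀ (Real.exp_pos _).le
        linarith [Real.exp_one_lt_d9]
    _ = 9 := by norm_num

lemma aux_core {k n : ℕ} [NeZero k] (hk : 2 ≤ k) (hn : 35 ≤ n)
    (β : ℝ) (hβ : 0 < β) (ρ ρ' : ℝ → ℝ) (hρ : IsTailFunction β ρ ρ')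
    (γ : ℝ) (hγ0 : 0 < γ) (hγ : γ ≤ 1 / 8) (T : ℕ)
    (η : ℝ) (hη : η = 1 / (6 * β * k))
    (a b z θ B : ℝ) (ha : 0 ≤ a) (hb : 0 ≤ b) (hab : a + b ≤ β)
    (hz : 0 ≤ tailInv ρ z) (har : a / 2 * tailInv ρ z ^ 2 ≤ z)
    (hθ : θ = 2 * a * γ ^ 2 / (3 * β))
    (hB : B ≤ (k / 18 : ℝ) * (auxF a b (tailInv ρ z) (tailInv ρ z * (1 - (1 - θ) ^ (T - 1))) +
      (1 / n) * auxF a b (tailInv ρ z)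
        (-(3 / 10) * (tailInv ρ z * (1 - (1 - θ) ^ (T - 1))) / γ))) :
    ∃ (D : ProbabilityMeasure ((Fin 3 → ℝ) × Fin k)) (ltil : (Fin (k - 1) → ℝ) → ℝ),
      (∀ᵐ z ∂(D : Measure ((Fin 3 → ℝ) × Fin k)), pnorm 2 z.1 ≤ 1) ∧
      (∃ Wstar : Fin k → Fin 3 → ℝ, frob Wstar ≤ 1 ∧
        ∀ᵐ z ∂(D : Measure ((Fin 3 → ℝ) × Fin k)),
          ∀ j, j ≠ z.2 → γ ≤ ∑ t, (Wstar z.2 t - Wstar j t) * z.1 t) ∧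
      (∀ u, 0 ≤ ltil u) ∧
      ConvexOn ℝ Set.univ ltil ∧
      Differentiable ℝ ltil ∧
      (∀ u v, pnorm 2 (grad ltil u - grad ltil v) ≤ β * pnorm 2 (u - v)) ∧
      (∀ u : Fin (k - 1) → ℝ, (∀ j, 0 ≤ u j) → ltil u ≤ ∑ j, ρ (u j)) ∧
      (∀ u : Fin (k - 1) → ℝ, (∀ j, 0 < u j) →
        Filter.Tendsto (fun t : ℝ => ltil (t • u)) Filter.atTop (nhds 0)) ∧
      B ≤
        ∫ ω : Fin n → (Fin 3 → ℝ) × Fin k,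
          (∫ z, ltil (Dmap z.2 (fun r => ∑ t,
              gdFrom η (fun W => (1 / n : ℝ) * ∑ i,
                  ltil (Dmap (ω i).2 (fun r' => ∑ t', W r' t' * (ω i).1 t'))) (T - 1) r t *
                z.1 t)) ∂(D : Measure ((Fin 3 → ℝ) × Fin k)))
          ∂(Measure.pi fun _ : Fin n => (D : Measure ((Fin 3 → ℝ) × Fin k))) := by
  set r := tailInv ρ z with hr
  have hn' : (35 : ℝ) ≤ n := by exact_mod_cast hn
  have hk' : (2 : ℝ) ≤ k := by exact_mod_cast hk
  have hq0 : (0 : ℝ) ≤ 1 / n := by positivity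
  have hq1 : 1 / (n : ℝ) ≤ 1 := by rw [div_le_one (by linarith)]; linarith
  have hp0 : (0 : ℝ) ≤ 1 - 1 / n := by linarith
  set z1 : (Fin 3 → ℝ) × Fin k := (![2 * γ, 0, 0], 0) with hz1
  set z3 : (Fin 3 → ℝ) × Fin k := (![-(3 / 5), 4 / 5, 0], 0) with hz3
  set D : Measure ((Fin 3 → ℝ) × Fin k) := ENNReal.ofReal (1 - 1 / n) • Measure.dirac z1 +
    ENNReal.ofReal (1 / n) • Measure.dirac z3 with hD
  have hDp : IsProbabilityMeasure D := by
    constructor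
    rw [hD]
    simp only [Measure.add_apply, Measure.smul_apply, smul_eq_mul, measure_univ, mul_one]
    rw [← ENNReal.ofReal_add hp0 hq0, sub_add_cancel, ENNReal.ofReal_one]
  have hae : ∀ P : (Fin 3 → ℝ) × Fin k → Prop, P z1 → P z3 → ∀ᵐ z ∂D, P z := by
    intro P h1 h3
    rw [hD, ae_add_measure_iff]
    refine ⟨Measure.ae_smul_measure ?_ _, Measure.ae_smul_measure ?_ _⟩
    · rw [ae_dirac_eq]; exact h1
    · rw [ae_dirac_eq]; exact h3
  refine ⟨⟨D, hDp⟩, auxL a b r, ?_, ?_, auxL_nonneg ha hb r, auxL_convex ha hb r,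
    fun u => (auxL_hasFDerivAt a b r u).differentiableAt, auxL_smooth ha hb hab r, ?_,
    auxL_tendsto a b hz, ?_⟩
  · apply hae
    · rw [aux_pnorm]
      apply Real.sqrt_le_one.mpr
      simp [hz1, Fin.sum_univ_three]
      rw [abs_of_pos hγ0]
      linarith
    · rw [aux_pnorm]
      apply Real.sqrt_le_one.mpr
      simp [hz3, Fin.sum_univ_three]
      norm_num
  · refine ⟨fun i => if i = 0 then ![3 / 5, 4 / 5, 0] else 0, ?_, ?_⟩
    · unfold frob
      apply Real.sqrt_le_one.mpr
      rw [Finset.sum_eq_single 0]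
      · simp [Fin.sum_univ_three]; norm_num
      · intro i _ hi; simp [hi]
      · simp
    · apply hae
      · intro j hj
        have hj' : j ≠ 0 := hj
        simp [hz1, hj', Fin.sum_univ_three]
        linarith
      · intro j hj
        have hj' : j ≠ 0 := hj
        simp [hz3, hj', Fin.sum_univ_three]
        linarith
  · intro u hu
    unfold auxL
    refine Finset.sum_le_sum fun j _ => ?_
    rcases lt_or_ge (u j) r with h | h
    · exact (auxF_le ha (hu j) har h.le).trans (tail_lt (hu j) h).le
    · rw [auxF_zero hz h]; exact hρ.nonneg _ (hu j)
  · have key := aux_integral (n := n) z1 z3 hp0 hq0 (by ring) D hD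
      (fun ω z => auxL a b r (Dmap z.2 (fun r' => ∑ t,
              gdFrom η (fun W => (1 / n : ℝ) * ∑ i,
                  auxL a b r (Dmap (ω i).2 (fun r' => ∑ t', W r' t' * (ω i).1 t'))) (T - 1) r' t *
                z.1 t))) (fun ω z => auxL_nonneg ha hb r _)
    refine le_trans ?_ key
    have hF : (fun W : Fin k → Fin 3 → ℝ => (1 / n : ℝ) * ∑ i : Fin n,
          auxL a b r (Dmap z1.2 (fun r' => ∑ t', W r' t' * z1.1 t'))) =
        fun W : Fin k → Fin 3 → ℝ =>
          ∑ j : Fin (k - 1), auxF a b r (2 * γ * (W 0 0 - W (skipIdx 0 j) 0)) := by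
      funext W
      rw [Finset.sum_const, Finset.card_univ, Fintype.card_fin, nsmul_eq_mul, ← mul_assoc,
        one_div_mul_cancel (by linarith), one_mul]
      unfold auxL
      refine Finset.sum_congr rfl fun j _ => ?_
      congr 1
      simp [hz1, Dmap, Fin.sum_univ_three]
      ring
    have hθ' : θ = (2 * γ) ^ 2 * k * η * a := by
      rw [hθ, hη]; field_simp; ring
    have hθ0 : 0 ≤ θ := by rw [hθ]; positivity
    have hθ1 : θ ≤ 1 := by
      rw [hθ, div_le_one (by positivity)]
      have hg1 : γ ^ 2 ≤ 1 := by nlinarith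
      have hg2 : a * γ ^ 2 ≤ a * 1 := mul_le_mul_of_nonneg_left hg1 (by linarith)
      linarith
    simp only [hF]
    rw [aux_gd a b r (2 * γ) η θ hz (by positivity) hθ' hθ0 hθ1]
    set U := r * (1 - (1 - θ) ^ (T - 1)) with hU
    have e1 : auxL a b r (Dmap z1.2 (fun r' => ∑ t, ((U / (2 * γ * k)) • auxV k) r' t * z1.1 t)) =
        (k - 1) * auxF a b r U := by
      unfold auxL
      have : ∀ j, Dmap z1.2 (fun r' => ∑ t, ((U / (2 * γ * k)) • auxV k) r' t * z1.1 t) j = U := by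
        intro j
        simp [hz1, Dmap, Fin.sum_univ_three, auxV, aux_skip_ne]
        field_simp
        ring
      simp only [this]
      simp [Nat.cast_sub (show 1 ≤ k by omega)]
    have e3 : auxL a b r (Dmap z3.2 (fun r' => ∑ t, ((U / (2 * γ * k)) • auxV k) r' t * z3.1 t)) =
        (k - 1) * auxF a b r (-(3 / 10) * U / γ) := by
      unfold auxL
      have : ∀ j, Dmap z3.2 (fun r' => ∑ t, ((U / (2 * γ * k)) • auxV k) r' t * z3.1 t) j =
          -(3 / 10) * U / γ := by
        intro j
        simp [hz3, Dmap, Fin.sum_univ_three, auxV, aux_skip_ne]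
        field_simp
        ring
      simp only [this]
      simp [Nat.cast_sub (show 1 ≤ k by omega)]
    rw [e1, e3]
    refine hB.trans ?_
    have hP := aux_pow hn
    have hP2 : (1 / 9 : ℝ) ≤ (1 - 1 / (n : ℝ)) ^ n :=
      hP.trans (pow_le_pow_of_le_one hp0 (by linarith) (by omega))
    have f1 := auxF_nonneg ha hb r U
    have f3 := mul_nonneg hq0 (auxF_nonneg ha hb r (-(3 / 10) * U / γ))
    have hk2 : (k : ℝ) / 2 ≤ k - 1 := by linarith
    generalize auxF a b r U = A at *
    generalize auxF a b r (-(3 / 10) * U / γ) = C at *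
    have s1 : (k : ℝ) / 18 ≤ (1 - 1 / (n : ℝ)) ^ (n + 1) * (k - 1) := by
      calc (k : ℝ) / 18 = 1 / 9 * (k / 2) := by ring
        _ ≤ _ := by gcongr
    have s2 : (k : ℝ) / 18 ≤ (1 - 1 / (n : ℝ)) ^ n * (k - 1) := by
      calc (k : ℝ) / 18 = 1 / 9 * (k / 2) := by ring
        _ ≤ _ := by gcongr
    calc (k : ℝ) / 18 * (A + 1 / n * C) = (k : ℝ) / 18 * A + (k : ℝ) / 18 * (1 / n * C) := by ring
      _ ≤ (1 - 1 / (n : ℝ)) ^ (n + 1) * (k - 1) * A + (1 - 1 / (n : ℝ)) ^ n * (k - 1) * (1 / n * C) := by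
          gcongr
      _ = _ := by rw [pow_succ]; ring

set_option maxHeartbeats 1000000 in
/-- the lower bound of the paper: for any tail function `ρ`, margin
`γ ≤ 1/8`, sample size `n ≥ 35`, horizon `T`, step size `η = 1/(6βk)` and suitable `ε`, there
exist a separable distribution with margin `γ` supported in the unit ball and a multiclass loss
with nonnegative, convex, `L₂`-`β`-smooth template bounded by `Σ_j ρ(u_j)` and decaying along
positive rays, on which the `T`-th GD iterate suffers expected risk at least
`c (β k ρ⁻¹(256ε/k)²/(γ²n) + β k ρ⁻¹(16ε/k)²/(γ²T))` with `c = 10⁻⁷`. -/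
theorem statement19 {k n : ℕ} [NeZero k] (hk : 2 ≤ k) (hn : 35 ≤ n)
    (β : ℝ) (hβ : 0 < β) (ρ ρ' : ℝ → ℝ) (hρ : IsTailFunction β ρ ρ')
    (γ : ℝ) (hγ0 : 0 < γ) (hγ : γ ≤ 1 / 8)
    (T : ℕ) (hT : 1 ≤ T)
    (η : ℝ) (hη : η = 1 / (6 * β * k))
    (ε : ℝ) (hε0 : 0 < ε) (hε1 : ε < 1 / 256)
    (hεT : (1 / ε) * tailInv ρ (ε / k) ^ 2 ≤ η * γ ^ 2 * T) :
    ∃ (D : ProbabilityMeasure ((Fin 3 → ℝ) × Fin k)) (ltil : (Fin (k - 1) → ℝ) → ℝ),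
      (∀ᵐ z ∂(D : Measure ((Fin 3 → ℝ) × Fin k)), pnorm 2 z.1 ≤ 1) ∧
      (∃ Wstar : Fin k → Fin 3 → ℝ, frob Wstar ≤ 1 ∧
        ∀ᵐ z ∂(D : Measure ((Fin 3 → ℝ) × Fin k)),
          ∀ j, j ≠ z.2 → γ ≤ ∑ t, (Wstar z.2 t - Wstar j t) * z.1 t) ∧
      (∀ u, 0 ≤ ltil u) ∧
      ConvexOn ℝ Set.univ ltil ∧
      Differentiable ℝ ltil ∧
      (∀ u v, pnorm 2 (grad ltil u - grad ltil v) ≤ β * pnorm 2 (u - v)) ∧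
      (∀ u : Fin (k - 1) → ℝ, (∀ j, 0 ≤ u j) → ltil u ≤ ∑ j, ρ (u j)) ∧
      (∀ u : Fin (k - 1) → ℝ, (∀ j, 0 < u j) →
        Filter.Tendsto (fun t : ℝ => ltil (t • u)) Filter.atTop (nhds 0)) ∧
      (10 : ℝ)⁻¹ ^ 7 *
          (β * k * tailInv ρ (256 * ε / k) ^ 2 / (γ ^ 2 * n) +
            β * k * tailInv ρ (16 * ε / k) ^ 2 / (γ ^ 2 * T)) ≤
        ∫ ω : Fin n → (Fin 3 → ℝ) × Fin k,
          (∫ z, ltil (Dmap z.2 (fun r => ∑ t,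
              gdFrom η (fun W => (1 / n : ℝ) * ∑ i,
                  ltil (Dmap (ω i).2 (fun r' => ∑ t', W r' t' * (ω i).1 t'))) (T - 1) r t *
                z.1 t)) ∂(D : Measure ((Fin 3 → ℝ) × Fin k)))
          ∂(Measure.pi fun _ : Fin n => (D : Measure ((Fin 3 → ℝ) × Fin k))) := by
  have hk' : (2 : ℝ) ≤ k := by exact_mod_cast hk
  have hn' : (35 : ℝ) ≤ n := by exact_mod_cast hn
  have hT' : (1 : ℝ) ≤ T := by exact_mod_cast hT
  have hk0 : (0 : ℝ) < k := by linarith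
  have hzs : ∀ c : ℝ, c ≤ 256 → c * ε / k ≤ 1 / 2 := by
    intro c hc
    rw [div_le_iff₀ hk0]
    nlinarith
  have hz0 : 0 < ε / k := by positivity
  have hz16 : 0 < 16 * ε / k := by positivity
  have hz256 : 0 < 256 * ε / k := by positivity
  have hzl : ε / k ≤ 1 / 512 := by
    rw [div_le_iff₀ hk0]; linarith
  have hbeta := tail_beta hβ hρ hz0 hzl
  have hR16 := tail_half hρ hz16 (hzs 16 (by norm_num))
  have hR256 := tail_half hρ hz256 (hzs 256 (by norm_num))
  have hm16 : tailInv ρ (16 * ε / k) ≤ tailInv ρ (ε / k) :=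
    tail_anti hρ hz0 (by gcongr; linarith)
  have hm256 : tailInv ρ (256 * ε / k) ≤ tailInv ρ (ε / k) :=
    tail_anti hρ hz0 (by gcongr; linarith)
  have hq16 : tailInv ρ (16 * ε / k) ^ 2 ≤ tailInv ρ (ε / k) ^ 2 :=
    pow_le_pow_left₀ (by linarith) hm16 2
  have hq256 : tailInv ρ (256 * ε / k) ^ 2 ≤ tailInv ρ (ε / k) ^ 2 :=
    pow_le_pow_left₀ (by linarith) hm256 2
  set R0 := tailInv ρ (ε / k) with hR0
  -- main consequence of the condition on `T`
  have hmain : 6 * β * k * R0 ^ 2 ≤ ε * (γ ^ 2 * T) := by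
    rw [hη, one_div_mul_eq_div, mul_assoc, one_div_mul_eq_div,
      div_le_div_iff₀ hε0 (by positivity)] at hεT
    linarith
  have hγT : 192 ≤ γ ^ 2 * T := by
    have h1 : 3 / 4 ≤ 6 * β * k * R0 ^ 2 := by nlinarith
    have h2 : 0 ≤ γ ^ 2 * (T : ℝ) := by positivity
    nlinarith
  have hγT0 : 0 < γ ^ 2 * (T : ℝ) := by linarith
  have hγn0 : 0 < γ ^ 2 * (n : ℝ) := by positivity
  have hT2 : (2 : ℝ) ≤ T := by
    have : γ ^ 2 ≤ 1 := by nlinarith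
    nlinarith
  have hTc : ((T - 1 : ℕ) : ℝ) = T - 1 := by rw [Nat.cast_sub hT]; simp
  rcases le_total (β * k * tailInv ρ (256 * ε / k) ^ 2 / (γ ^ 2 * n))
    (β * k * tailInv ρ (16 * ε / k) ^ 2 / (γ ^ 2 * T)) with hcase | hcase
  · -- the optimization term dominates
    set R := tailInv ρ (16 * ε / k) with hR
    have ha : 0 ≤ 3 / 4 * β / (γ ^ 2 * T) := by positivity
    refine aux_core hk hn β hβ ρ ρ' hρ γ hγ0 hγ T η hη (3 / 4 * β / (γ ^ 2 * T)) 0 (16 * ε / k)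
      (2 * (3 / 4 * β / (γ ^ 2 * T)) * γ ^ 2 / (3 * β)) _ ha le_rfl ?_ (by rw [← hR]; linarith) ?_
      rfl ?_
    · rw [add_zero, div_le_iff₀ hγT0]; nlinarith
    · rw [← hR]
      rw [div_div, div_mul_eq_mul_div, div_le_div_iff₀ (by positivity) hk0]
      have : β * k * R ^ 2 ≤ β * k * R0 ^ 2 := by gcongr
      nlinarith
    · rw [← hR]
      set θ := 2 * (3 / 4 * β / (γ ^ 2 * T)) * γ ^ 2 / (3 * β) with hθ
      have hθv : θ = 1 / (2 * T) := by rw [hθ]; field_simp; norm_num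
      have hθT : θ * T = 1 / 2 := by rw [hθv]; field_simp
      have hθ0 : 0 < θ := by rw [hθv]; positivity
      have hθ1 : θ ≤ 1 := by nlinarith
      have hpow : 1 / 2 ≤ (1 - θ) ^ (T - 1) := by
        have := one_add_mul_le_pow (show (-2 : ℝ) ≤ -θ by linarith) (T - 1)
        rw [hTc, ← sub_eq_add_neg] at this
        nlinarith
      have h3 := mul_nonneg (show (0:ℝ) ≤ 1 / n by positivity) (auxF_nonneg ha le_rfl R
        (-(3 / 10) * (R * (1 - (1 - θ) ^ (T - 1))) / γ))
      have h1 : 3 / 32 * (β * R ^ 2 / (γ ^ 2 * T)) ≤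
          auxF (3 / 4 * β / (γ ^ 2 * T)) 0 R (R * (1 - (1 - θ) ^ (T - 1))) := by
        unfold auxF
        have h4 : R / 2 ≤ max (R - R * (1 - (1 - θ) ^ (T - 1))) 0 := by
          apply le_max_of_le_left
          nlinarith
        have h5 : (R / 2) ^ 2 ≤ max (R - R * (1 - (1 - θ) ^ (T - 1))) 0 ^ 2 :=
          pow_le_pow_left₀ (by linarith) h4 2
        have h6 := mul_le_mul_of_nonneg_left h5 (half_pos (show 0 < 3 / 4 * β / (γ ^ 2 * T) by
          positivity)).le
        have h7 : 3 / 4 * β / (γ ^ 2 * T) / 2 * (R / 2) ^ 2 = 3 / 32 * (β * R ^ 2 / (γ ^ 2 * T)) := by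
          ring
        linarith
      have hX : 0 ≤ β * k * R ^ 2 / (γ ^ 2 * T) := by positivity
      calc _ ≤ (10 : ℝ)⁻¹ ^ 7 * (β * k * R ^ 2 / (γ ^ 2 * T) + β * k * R ^ 2 / (γ ^ 2 * T)) := by
            gcongr
        _ ≤ k / 18 * (3 / 32 * (β * R ^ 2 / (γ ^ 2 * T))) := by
            have : (k : ℝ) / 18 * (3 / 32 * (β * R ^ 2 / (γ ^ 2 * T))) =
              1 / 192 * (β * k * R ^ 2 / (γ ^ 2 * T)) := by ring
            rw [this]
            norm_num
            linarith
        _ ≤ _ := by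
            gcongr
            linarith
  · -- the generalization term dominates
    set R := tailInv ρ (256 * ε / k) with hR
    have hRp : 0 < R := by linarith
    set a := min β (512 * ε / (k * R ^ 2)) with ha
    have ha0 : 0 < a := lt_min hβ (by positivity)
    have haβ : a ≤ β := min_le_left _ _
    refine aux_core hk hn β hβ ρ ρ' hρ γ hγ0 hγ T η hη a (β - a) (256 * ε / k)
      (2 * a * γ ^ 2 / (3 * β)) _ ha0.le (by linarith) (by linarith) (by rw [← hR]; linarith) ?_
      rfl ?_
    · rw [← hR]
      calc a / 2 * R ^ 2 ≤ (512 * ε / (k * R ^ 2)) / 2 * R ^ 2 := by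
            gcongr; exact min_le_right _ _
        _ = 256 * ε / k := by field_simp; norm_num
    · rw [← hR]
      set θ := 2 * a * γ ^ 2 / (3 * β) with hθ
      have hθ0 : 0 < θ := by rw [hθ]; positivity
      have hθ1 : θ ≤ 1 := by
        rw [hθ, div_le_one (by positivity)]
        have hg1 : γ ^ 2 ≤ 1 := by nlinarith
        have hg2 : a * γ ^ 2 ≤ a * 1 := mul_le_mul_of_nonneg_left hg1 (by linarith)
        linarith
      have hθT : 2 ≤ θ * T := by
        rw [hθ, div_mul_eq_mul_div, le_div_iff₀ (by positivity)]
        rcases min_choice β (512 * ε / (k * R ^ 2)) with h | h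
        · rw [ha, h]; nlinarith
        · rw [ha, h]
          have : 2 * (512 * ε / (k * R ^ 2)) * γ ^ 2 * T =
              1024 * (ε * (γ ^ 2 * T)) / (k * R ^ 2) := by ring
          rw [this, le_div_iff₀ (by positivity)]
          have : β * k * R ^ 2 ≤ β * k * R0 ^ 2 := by gcongr
          have h0 : 0 ≤ β * k * R ^ 2 := by positivity
          nlinarith
      have hpow : (1 - θ) ^ (T - 1) ≤ 1 / 2 := by
        have h1 : (1 - θ) ^ (T - 1) ≤ Real.exp (-θ) ^ (T - 1) := by
          apply pow_le_pow_left₀ (by linarith)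
          linarith [Real.add_one_le_exp (-θ)]
        rw [← Real.exp_nat_mul, hTc] at h1
        have h2 : ((T : ℝ) - 1) * -θ ≤ -1 := by nlinarith
        have h3 := Real.exp_le_exp.mpr h2
        have h4 : Real.exp (-1) ≤ 1 / 2 := by
          rw [Real.exp_neg, one_div]
          apply inv_anti₀ (by norm_num)
          linarith [Real.add_one_le_exp (1 : ℝ)]
        linarith
      set U := R * (1 - (1 - θ) ^ (T - 1)) with hU
      have hUR : R / 2 ≤ U := by rw [hU]; nlinarith
      have h1 := auxF_nonneg ha0.le (show 0 ≤ β - a by linarith) R U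
      have h3 : 9 / 800 * (β * R ^ 2 / γ ^ 2) ≤ auxF a (β - a) R (-(3 / 10) * U / γ) := by
        unfold auxF
        have hv : 3 / 20 * R / γ ≤ -(-(3 / 10) * U / γ) := by
          rw [← neg_div]; gcongr; linarith
        set v := -(3 / 10) * U / γ with hvdef
        have hv0 : 0 ≤ 3 / 20 * R / γ := by positivity
        have h4 : (3 / 20 * R / γ) ^ 2 ≤ max (R - v) 0 ^ 2 :=
          pow_le_pow_left₀ hv0 (le_max_of_le_left (by linarith)) 2
        have h5 : (3 / 20 * R / γ) ^ 2 ≤ max (- v) 0 ^ 2 :=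
          pow_le_pow_left₀ hv0 (le_max_of_le_left (by linarith)) 2
        have h6 := mul_le_mul_of_nonneg_left h4 (half_pos ha0).le
        have h7 := mul_le_mul_of_nonneg_left h5 (show 0 ≤ (β - a) / 2 by linarith)
        have h8 : a / 2 * (3 / 20 * R / γ) ^ 2 + (β - a) / 2 * (3 / 20 * R / γ) ^ 2 =
          9 / 800 * (β * R ^ 2 / γ ^ 2) := by ring
        linarith
      have hX : 0 ≤ β * k * R ^ 2 / (γ ^ 2 * n) := by positivity
      calc _ ≤ (10 : ℝ)⁻¹ ^ 7 * (β * k * R ^ 2 / (γ ^ 2 * n) + β * k * R ^ 2 / (γ ^ 2 * n)) := by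
            gcongr
        _ ≤ k / 18 * (1 / n * (9 / 800 * (β * R ^ 2 / γ ^ 2))) := by
            have : (k : ℝ) / 18 * (1 / n * (9 / 800 * (β * R ^ 2 / γ ^ 2))) =
              1 / 1600 * (β * k * R ^ 2 / (γ ^ 2 * n)) := by field_simp; norm_num
            rw [this]
            norm_num
            linarith
        _ ≤ k / 18 * (1 / n * auxF a (β - a) R (-(3 / 10) * U / γ)) := by gcongr
        _ ≤ _ := by
            gcongr
            linarith
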